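/- Let k ≥ 4. For every n ∈ ℕ, the longest common prefix of the word ξ^{n+2k−1}(0)ξ^n(0) and the infinite word u_k is ξ^{n+2k−1}(0); that is, ξ^{n+2k−1}(0) followed by the letter 0 is a prefix of ξ^{n+2k−1}(0)ξ^n(0), while ξ^{n+2k−1}(0) followed by the letter 0′ is a prefix of u_k. -/

import Mathlib

open List Filter Topology

/-- The alphabet `A`: the letter `(b, j)` is the unprimed letter `j` if `b = false`
and the primed letter `j′` if `b = true`.  Only letters with `j < k` occur. -/
abbrev Letter : Type := Bool × ℕ

/-- The morphism ξ_k on letters: `0 ↦ 01`, `j ↦ j+1` for `1 ≤ j ≤ k−2`, `k−1 ↦ 0′`,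
and symmetrically on primed letters with `(k−1)′ ↦ 0`. -/
def xiL (k : ℕ) (a : Letter) : List Letter :=
  if a.2 = 0 then [(a.1, 0), (a.1, 1)]
  else if a.2 = k - 1 then [(!a.1, 0)]
  else [(a.1, a.2 + 1)]

/-- The morphism ξ_k on finite words. -/
def xiW (k : ℕ) (w : List Letter) : List Letter := w.flatMap (xiL k)

/-- The word ξ_k^n(0). -/
def xiPow (k n : ℕ) : List Letter := (xiW k)^[n] [((false : Bool), (0 : ℕ))]

/-- The projection π : A → {0,1}, with `false` playing the role of `0` and
`true` the role of `1`. -/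
def proj (a : Letter) : Bool := if a.2 = 0 then a.1 else !a.1

/-- The twin map `ℓ ↔ ℓ′` on letters. -/
def twin (a : Letter) : Letter := (!a.1, a.2)

/-- The finite word `w` occurs in the infinite word `v` at position `j`. -/
def OccursAt {α : Type*} (w : List α) (v : ℕ → α) (j : ℕ) : Prop :=
  ∀ i, i < w.length → w[i]? = some (v (j + i))

/-- The finite word `w` is a prefix of the infinite word `v`. -/
def PrefixSeq {α : Type*} (w : List α) (v : ℕ → α) : Prop := OccursAt w v 0

/-- The finite word `w` is a factor of the infinite word `v`. -/
def FactorOf {α : Type*} (w : List α) (v : ℕ → α) : Prop := ∃ j, OccursAt w v j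

/-- `v` is the fixed point `u_k = ξ_k^ω(0)`: every `ξ_k^n(0)` is a prefix of `v`. -/
def IsFixedPoint (k : ℕ) (v : ℕ → Letter) : Prop := ∀ n, PrefixSeq (xiPow k n) v

/-- `q ≥ 1` is a period of the finite word `z`. -/
def HasPeriod {α : Type*} (z : List α) (q : ℕ) : Prop :=
  1 ≤ q ∧ ∀ i, i + q < z.length → z[i]? = z[i + q]?

/-- `w` is a left special factor of the infinite word `v`. -/
def LeftSpecial {α : Type*} (w : List α) (v : ℕ → α) : Prop :=
  ∃ a b : α, a ≠ b ∧ FactorOf (a :: w) v ∧ FactorOf (b :: w) v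

/-- `w` is a right special factor of the infinite word `v`. -/
def RightSpecial {α : Type*} (w : List α) (v : ℕ → α) : Prop :=
  ∃ a b : α, a ≠ b ∧ FactorOf (w ++ [a]) v ∧ FactorOf (w ++ [b]) v

/-- `w` is a bispecial factor of the infinite word `v`. -/
def Bispecial {α : Type*} (w : List α) (v : ℕ → α) : Prop :=
  LeftSpecial w v ∧ RightSpecial w v

/-- The set of left extensions of `w` in `v`. -/
def Lext {α : Type*} (w : List α) (v : ℕ → α) : Set α := {a | FactorOf (a :: w) v}

/-- The set of right extensions of `w` in `v`. -/
def Rext {α : Type*} (w : List α) (v : ℕ → α) : Set α := {a | FactorOf (w ++ [a]) v}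

/-- `r` is a return word to `w` in `v`: it spans two consecutive occurrences of `w`. -/
def ReturnWordTo {α : Type*} (r w : List α) (v : ℕ → α) : Prop :=
  ∃ j ℓ, j < ℓ ∧ OccursAt w v j ∧ OccursAt w v ℓ ∧
    (∀ m, j < m → m < ℓ → ¬ OccursAt w v m) ∧
    r = (List.range (ℓ - j)).map (fun i => v (j + i))

/-- The factor complexity of an infinite word. -/
noncomputable def complexity {α : Type*} (v : ℕ → α) (n : ℕ) : ℕ :=
  {w : List α | w.length = n ∧ FactorOf w v}.ncard

theorem xiW_append (k : ℕ) (v w : List Letter) : xiW k (v ++ w) = xiW k v ++ xiW k w :=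
  List.flatMap_append

theorem xiW_iterate_append (k n : ℕ) (v w : List Letter) :
    (xiW k)^[n] (v ++ w) = (xiW k)^[n] v ++ (xiW k)^[n] w := by
  induction n generalizing v w with
  | zero => rfl
  | succ n ih => simp only [Function.iterate_succ_apply, xiW_append, ih]

theorem xiW_singleton_zero (k : ℕ) (b : Bool) : xiW k [(b, 0)] = [(b, 0)] ++ [(b, 1)] := by
  simp [xiW, xiL]

theorem singleton_zero_prefix_xiW_iterate (k n : ℕ) (b : Bool) :
    [(b, 0)] <+: (xiW k)^[n] [(b, 0)] := by
  induction n with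
  | zero => exact List.prefix_rfl
  | succ n ih =>
    rw [Function.iterate_succ_apply, xiW_singleton_zero, xiW_iterate_append]
    exact ih.trans (List.prefix_append _ _)

theorem xiW_iterate_singleton_one (k j : ℕ) (b : Bool) (hj : j + 1 < k) :
    (xiW k)^[j] [(b, 1)] = [(b, j + 1)] := by
  induction j with
  | zero => rfl
  | succ j ih =>
    have hne : j + 1 ≠ k - 1 := by lia
    rw [Function.iterate_succ_apply', ih (by lia)]
    simp [xiW, xiL, hne]

theorem xiW_iterate_pred_singleton_one (k : ℕ) (hk : 2 ≤ k) (b : Bool) :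
    (xiW k)^[k - 1] [(b, 1)] = [(!b, 0)] := by
  obtain ⟨j, rfl⟩ := Nat.exists_eq_add_of_le' hk
  rw [show j + 2 - 1 = j + 1 from rfl, Function.iterate_succ_apply',
    xiW_iterate_singleton_one _ _ _ (by lia)]
  simp [xiW, xiL]

/-- For `N ≥ k - 1`, the word `ξ^N(0)` is followed by the letter `0′` in `ξ^{N+1}(0)`. -/
theorem xiPow_append_twin_zero_prefix (k N : ℕ) (hk : 2 ≤ k) (hN : k - 1 ≤ N) :
    xiPow k N ++ [((true : Bool), (0 : ℕ))] <+: xiPow k (N + 1) := by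
  obtain ⟨m, rfl⟩ := Nat.exists_eq_add_of_le' hN
  have h : xiPow k (m + (k - 1) + 1) =
      xiPow k (m + (k - 1)) ++ (xiW k)^[m] [((true : Bool), (0 : ℕ))] := by
    rw [xiPow, Function.iterate_succ_apply, xiW_singleton_zero, xiW_iterate_append,
      Function.iterate_add_apply _ m (k - 1) [(false, 1)], xiW_iterate_pred_singleton_one k hk]
    rfl
  rw [h, List.prefix_append_right_inj]
  exact singleton_zero_prefix_xiW_iterate k m true

theorem PrefixSeq.of_prefix {α : Type*} {v w : List α} {u : ℕ → α} (hw : PrefixSeq w u)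
    (h : v <+: w) : PrefixSeq v u := by
  obtain ⟨t, rfl⟩ := h
  intro i hi
  rw [← hw i (by rw [List.length_append]; lia), List.getElem?_append_left hi]

/-- for `k ≥ 4` and every `n`, the longest common prefix of
`ξ^{n+2k−1}(0)ξ^n(0)` and `u_k` is `ξ^{n+2k−1}(0)`: indeed `ξ^{n+2k−1}(0)·0` is a
prefix of `ξ^{n+2k−1}(0)ξ^n(0)`, while `ξ^{n+2k−1}(0)·0′` is a prefix of `u_k`. -/
theorem stmt_19 (k : ℕ) (hk : 4 ≤ k) (u : ℕ → Letter) (hu : IsFixedPoint k u) :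
    ∀ n : ℕ,
      (xiPow k (n + 2 * k - 1) ++ [((false : Bool), (0 : ℕ))]) <+:
        (xiPow k (n + 2 * k - 1) ++ xiPow k n) ∧
      PrefixSeq (xiPow k (n + 2 * k - 1) ++ [((true : Bool), (0 : ℕ))]) u := by
  intro n
  refine ⟨?_, (hu _).of_prefix (xiPow_append_twin_zero_prefix k _ (by lia) (by lia))⟩
  rw [List.prefix_append_right_inj]
  exact singleton_zero_prefix_xiW_iterate k n false
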